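/- Let p be a prime, k a field of characteristic p, and E = C_p × ⋯ × C_p (r factors) an elementary abelian p-group of rank r. Then every finite-dimensional kE-module admits good permutation resolutions. -/

import Mathlib

open CategoryTheory

def IsPermutationModule (k G : Type) [Field k] [Group G]
    (P : Type) [AddCommGroup P] [Module (MonoidAlgebra k G) P] : Prop :=
  ∃ (X : Type) (_ : Fintype X) (m : MulAction G X),
    Nonempty (P ≃ₗ[MonoidAlgebra k G] (@Representation.ofMulAction k _ G _ X m).asModule)

def HasPermResFreeUpTo (k G : Type) [Field k] [Group G] (m : ℕ)
    (M : Type) [AddCommGroup M] [Module (MonoidAlgebra k G) M] : Prop :=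
  ∃ (n : ℕ) (P : ℕ → ModuleCat (MonoidAlgebra k G))
    (d : ∀ i, P (i + 1) ⟶ P i) (ε : P 0 ⟶ ModuleCat.of (MonoidAlgebra k G) M),
    (∀ i, IsPermutationModule k G (P i)) ∧
    (∀ i ≤ m, Module.Free (MonoidAlgebra k G) (P i)) ∧
    (∀ i, n < i → Subsingleton (P i)) ∧
    Function.Surjective ε ∧
    Function.Exact (d 0) ε ∧
    ∀ i, Function.Exact (d (i + 1)) (d i)

def HasFinitePermRes (k G : Type) [Field k] [Group G]
    (M : Type) [AddCommGroup M] [Module (MonoidAlgebra k G) M] : Prop :=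
  ∃ (n : ℕ) (P : ℕ → ModuleCat (MonoidAlgebra k G))
    (d : ∀ i, P (i + 1) ⟶ P i) (ε : P 0 ⟶ ModuleCat.of (MonoidAlgebra k G) M),
    (∀ i, IsPermutationModule k G (P i)) ∧
    (∀ i, n < i → Subsingleton (P i)) ∧
    Function.Surjective ε ∧
    Function.Exact (d 0) ε ∧
    ∀ i, Function.Exact (d (i + 1)) (d i)

def HasGoodPermRes (k G : Type) [Field k] [Group G]
    (M : Type) [AddCommGroup M] [Module (MonoidAlgebra k G) M] : Prop :=
  ∀ m : ℕ, HasPermResFreeUpTo k G m M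

/-- A property of modules over a fixed ring. -/
abbrev ModuleClass (A : Type) [CommRing A] : Type 1 :=
  ∀ (P : Type) [AddCommGroup P] [Module A P], Prop

section Resolution

variable {A : Type} [CommRing A]

/-- `f` is surjective on elements annihilated by `z`. -/
def TorsionSurjective (z : A) {X Y : Type} [AddCommGroup X] [Module A X] [AddCommGroup Y]
    [Module A Y] (f : X →ₗ[A] Y) : Prop :=
  ∀ y, z • y = 0 → ∃ x, z • x = 0 ∧ f x = y

lemma torsionSurjective_zero {X Y : Type} [AddCommGroup X] [Module A X] [AddCommGroup Y]
    [Module A Y] {f : X →ₗ[A] Y} (hf : Function.Surjective f) :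
    TorsionSurjective (0 : A) f := by
  intro y _
  obtain ⟨x, rfl⟩ := hf y
  exact ⟨x, zero_smul _ _, rfl⟩

/-- `M` has a resolution of length at most `n` whose `i`-th term lies in the class `c i`, and all
of whose syzygy maps are surjective on elements annihilated by `z`. -/
def Resolves (z : A) : ℕ → (ℕ → ModuleClass A) → ModuleClass A
  | 0, _, M, _, _ => Subsingleton M
  | n + 1, c, M, _, _ => ∃ (P : Type) (_ : AddCommGroup P) (_ : Module A P) (f : P →ₗ[A] M),
      c 0 P ∧ Function.Surjective f ∧ TorsionSurjective z f ∧
        Resolves z n (fun i => c (i + 1)) (LinearMap.ker f)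

/-- Projectivity relative to maps which are surjective, also on elements annihilated by `z`. -/
def TorsionProjective (z : A) : ModuleClass A := fun Q _ _ =>
  ∀ (X Y : Type) [AddCommGroup X] [Module A X] [AddCommGroup Y] [Module A Y] (f : X →ₗ[A] Y)
    (g : Q →ₗ[A] Y), Function.Surjective f → TorsionSurjective z f → ∃ h : Q →ₗ[A] X, f ∘ₗ h = g

lemma TorsionProjective.of_projective (z : A) (Q : Type) [AddCommGroup Q] [Module A Q]
    [Module.Projective A Q] : TorsionProjective z Q := fun _ _ _ _ _ _ f g hf _ =>
  Module.projective_lifting_property f g hf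

lemma TorsionProjective.prod {z : A} {P Q : Type} [AddCommGroup P] [Module A P] [AddCommGroup Q]
    [Module A Q] (hP : TorsionProjective z P) (hQ : TorsionProjective z Q) :
    TorsionProjective z (P × Q) := by
  intro X Y _ _ _ _ f g hf hz
  obtain ⟨a, ha⟩ := hP X Y f (g ∘ₗ LinearMap.inl A P Q) hf hz
  obtain ⟨b, hb⟩ := hQ X Y f (g ∘ₗ LinearMap.inr A P Q) hf hz
  refine ⟨a.coprod b, ?_⟩
  rw [LinearMap.comp_coprod, ha, hb]
  ext <;> simp

lemma Resolves.of_equiv {z : A} {n : ℕ} {c : ℕ → ModuleClass A} {M N : Type} [AddCommGroup M]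
    [Module A M] [AddCommGroup N] [Module A N] (e : M ≃ₗ[A] N) (h : Resolves z n c M) :
    Resolves z n c N := by
  cases n with
  | zero =>
    have : Subsingleton M := h
    exact e.symm.toEquiv.subsingleton
  | succ n =>
    obtain ⟨P, _, _, f, hc, hf, hz, hK⟩ := h
    refine ⟨P, _, _, e.toLinearMap ∘ₗ f, hc, e.surjective.comp hf, ?_, ?_⟩
    · intro y hy
      obtain ⟨x, hx, hxy⟩ := hz (e.symm y) (by rw [← map_smul, hy, map_zero])
      exact ⟨x, hx, by simp [hxy]⟩
    · rw [LinearEquiv.ker_comp]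
      exact hK

lemma Resolves.of_exact {z : A} {n : ℕ} {c : ℕ → ModuleClass A} {K P M : Type} [AddCommGroup K]
    [Module A K] [AddCommGroup P] [Module A P] [AddCommGroup M] [Module A M]
    (ι : K →ₗ[A] P) (f : P →ₗ[A] M) (hι : Function.Injective ι) (hf : Function.Surjective f)
    (hex : Function.Exact ι f) (hz : TorsionSurjective z f) (hP : c 0 P)
    (hK : Resolves z n (fun i => c (i + 1)) K) : Resolves z (n + 1) c M := by
  refine ⟨P, _, _, f, hP, hf, hz, hK.of_equiv ?_⟩
  exact (LinearEquiv.ofInjective ι hι).trans (LinearEquiv.ofEq _ _ hex.linearMap_ker_eq.symm)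

lemma Resolves.mono {z : A} {n : ℕ} {c d : ℕ → ModuleClass A} {M : Type} [AddCommGroup M]
    [Module A M] (h : Resolves z n c M)
    (hcd : ∀ i (P : Type) [AddCommGroup P] [Module A P], c i P → d i P) :
    Resolves z n d M := by
  induction n generalizing c d M with
  | zero => exact h
  | succ n ih =>
    obtain ⟨P, _, _, f, hc, hf, hz, hK⟩ := h
    exact ⟨P, _, _, f, hcd _ _ hc, hf, hz, ih hK fun i Q _ _ => hcd (i + 1) Q⟩

lemma Resolves.of_subsingleton {z : A} {n : ℕ} {c : ℕ → ModuleClass A} {M : Type}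
    [AddCommGroup M] [Module A M] [Subsingleton M] (hc : ∀ i, c i PUnit) :
    Resolves z n c M := by
  induction n generalizing c M with
  | zero => assumption
  | succ n ih =>
    exact ⟨PUnit, _, _, 0, hc 0, fun y => ⟨0, Subsingleton.elim _ _⟩,
      fun y _ => ⟨0, Subsingleton.elim _ _, Subsingleton.elim _ _⟩, ih fun i => hc (i + 1)⟩

lemma Resolves.succ {z : A} {n : ℕ} {c : ℕ → ModuleClass A} {M : Type} [AddCommGroup M]
    [Module A M] (h : Resolves z n c M) (hc : ∀ i, c i PUnit) : Resolves z (n + 1) c M := by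
  induction n generalizing c M with
  | zero =>
    have : Subsingleton M := h
    exact .of_subsingleton hc
  | succ n ih =>
    obtain ⟨P, _, _, f, hP, hf, hz, hK⟩ := h
    exact ⟨P, _, _, f, hP, hf, hz, ih hK fun i => hc (i + 1)⟩

/-- Horseshoe lemma: the lifts are only needed up to the length of the resolution of the
submodule. -/
theorem Resolves.extension {z : A} {n n' : ℕ} {c d e : ℕ → ModuleClass A} {L X N : Type}
    [AddCommGroup L] [Module A L] [AddCommGroup X] [Module A X] [AddCommGroup N] [Module A N]
    (ι : L →ₗ[A] X) (π : X →ₗ[A] N) (hι : Function.Injective ι) (hπ : Function.Surjective π)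
    (hex : Function.Exact ι π) (hz : TorsionSurjective z π)
    (hL : Resolves z n c L) (hN : Resolves 0 n' d N)
    (hd : ∀ i < n, ∀ (Q : Type) [AddCommGroup Q] [Module A Q], d i Q → TorsionProjective z Q)
    (hd0 : ∀ i, d i PUnit)
    (hde : ∀ i (Q : Type) [AddCommGroup Q] [Module A Q], d i Q → e i Q)
    (hcde : ∀ i (P Q : Type) [AddCommGroup P] [Module A P] [AddCommGroup Q] [Module A Q],
      c i P → d i Q → e i (P × Q)) :
    ∃ l, Resolves 0 l e X := by
  induction n generalizing n' c d e L X N with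
  | zero =>
    have : Subsingleton L := hL
    have hinj : Function.Injective π := by
      rw [← LinearMap.ker_eq_bot, hex.linearMap_ker_eq, LinearMap.range_eq_bot]
      exact LinearMap.ext fun x => by rw [Subsingleton.elim x 0, map_zero, map_zero]
    exact ⟨n', (hN.of_equiv (LinearEquiv.ofBijective π ⟨hinj, hπ⟩).symm).mono hde⟩
  | succ n ih =>
    obtain ⟨P, _, _, f, hP, hf, hfz, hK⟩ := hL
    obtain ⟨Q, _, _, g, hQ, hg, -, hK'⟩ := hN.succ hd0
    obtain ⟨s, hs⟩ := hd 0 n.succ_pos Q hQ X N π g hπ hz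
    have hs' : ∀ q, π (s q) = g q := fun q => LinearMap.congr_fun hs q
    have hπι : ∀ x, π (ι x) = 0 := fun x => (hex _).2 ⟨x, rfl⟩
    set F : P × Q →ₗ[A] X := (ι ∘ₗ f).coprod s with hF
    have hFap : ∀ p q, F (p, q) = ι (f p) + s q := fun p q => by simp [hF]
    have hker : ∀ {w : P × Q}, F w = 0 → g w.2 = 0 := by
      rintro ⟨p, q⟩ hw
      have := congrArg π hw
      simpa [hFap, hπι, hs'] using this
    have hFs : Function.Surjective F := by
      intro x
      obtain ⟨q, hq⟩ := hg (π x)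
      obtain ⟨l, hl⟩ := (hex (x - s q)).1 (by simp [hs', hq])
      obtain ⟨p, rfl⟩ := hf l
      exact ⟨(p, q), by rw [hFap, hl]; abel⟩
    have hlift : ∀ q, g q = 0 → ∃ l, ι l = s q := fun q hq =>
      (hex _).1 (by rw [hs', hq])
    let a : LinearMap.ker f →ₗ[A] LinearMap.ker F :=
      (LinearMap.inl A P Q ∘ₗ (LinearMap.ker f).subtype).codRestrict _ fun x => by
        simp [hFap]
    let b : LinearMap.ker F →ₗ[A] LinearMap.ker g :=
      (LinearMap.snd A P Q ∘ₗ (LinearMap.ker F).subtype).codRestrict _ fun x => by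
        simpa using hker x.2
    have ha : Function.Injective a := by
      intro x y hxy
      exact Subtype.ext (congrArg Prod.fst (congrArg Subtype.val hxy))
    have hb : Function.Surjective b := by
      rintro ⟨q, hq⟩
      obtain ⟨l, hl⟩ := hlift q hq
      obtain ⟨p, rfl⟩ := hf l
      exact ⟨⟨(-p, q), by simp [hFap, hl]⟩, rfl⟩
    have hbz : TorsionSurjective z b := by
      rintro ⟨q, hq⟩ hzq
      have hzq : z • q = 0 := congrArg Subtype.val hzq
      obtain ⟨l, hl⟩ := hlift q hq
      obtain ⟨p, hzp, rfl⟩ := hfz l (hι (by rw [map_smul, hl, ← map_smul, hzq, map_zero, map_zero]))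
      exact ⟨⟨(-p, q), by simp [hFap, hl]⟩, Subtype.ext (by simp [hzp, hzq]), rfl⟩
    have hab : Function.Exact a b := by
      rintro ⟨⟨p, q⟩, hpq⟩
      constructor
      · intro h
        have hq : q = 0 := congrArg Subtype.val h
        subst hq
        have hp : f p = 0 := hι (by simpa [hFap] using hpq)
        exact ⟨⟨p, hp⟩, rfl⟩
      · rintro ⟨x, hx⟩
        rw [← hx]
        rfl
    obtain ⟨l, hl⟩ := ih a b ha hb hab hbz hK hK'
      (fun i hi => hd (i + 1) (Nat.succ_lt_succ hi)) (fun i => hd0 (i + 1))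
      (fun i => hde (i + 1)) (fun i => hcde (i + 1))
    exact ⟨l + 1, P × Q, _, _, F, hcde 0 P Q hP hQ, hFs, torsionSurjective_zero hFs, hl⟩

theorem Resolves.quotient {z : A} {n n' : ℕ} {c d e : ℕ → ModuleClass A} {L M N : Type}
    [AddCommGroup L] [Module A L] [AddCommGroup M] [Module A M] [AddCommGroup N] [Module A N]
    (ι : L →ₗ[A] M) (π : M →ₗ[A] N) (hι : Function.Injective ι) (hπ : Function.Surjective π)
    (hex : Function.Exact ι π)
    (hM : Resolves z (n + 1) c M) (hL : Resolves 0 n' d L)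
    (hd : ∀ i < n, ∀ (Q : Type) [AddCommGroup Q] [Module A Q], d i Q → TorsionProjective z Q)
    (hd0 : ∀ i, d i PUnit)
    (hce : ∀ (P : Type) [AddCommGroup P] [Module A P], c 0 P → e 0 P)
    (hde : ∀ i (Q : Type) [AddCommGroup Q] [Module A Q], d i Q → e (i + 1) Q)
    (hcde : ∀ i (P Q : Type) [AddCommGroup P] [Module A P] [AddCommGroup Q] [Module A Q],
      c (i + 1) P → d i Q → e (i + 1) (P × Q)) :
    ∃ l, Resolves 0 l e N := by
  obtain ⟨P, _, _, f, hP, hf, hfz, hK⟩ := hM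
  have hL' : Resolves 0 n' d (LinearMap.ker π) := hL.of_equiv
    ((LinearEquiv.ofInjective ι hι).trans (LinearEquiv.ofEq _ _ hex.linearMap_ker_eq.symm))
  let a : LinearMap.ker f →ₗ[A] LinearMap.ker (π ∘ₗ f) :=
    Submodule.inclusion (LinearMap.ker_le_ker_comp f π)
  let b : LinearMap.ker (π ∘ₗ f) →ₗ[A] LinearMap.ker π :=
    (f ∘ₗ (LinearMap.ker (π ∘ₗ f)).subtype).codRestrict _ fun x => x.2
  have hb : ∀ y, ∃ x, b x = y ∧ (z • y = 0 → z • x = 0) := by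
    rintro ⟨y, hy⟩
    by_cases h : z • y = 0
    · obtain ⟨x, hx, rfl⟩ := hfz y h
      exact ⟨⟨x, hy⟩, rfl, fun _ => Subtype.ext hx⟩
    · obtain ⟨x, rfl⟩ := hf y
      exact ⟨⟨x, hy⟩, rfl, fun h' => absurd (congrArg Subtype.val h') h⟩
  have hab : Function.Exact a b := by
    rintro ⟨p, hp⟩
    constructor
    · intro h
      exact ⟨⟨p, congrArg Subtype.val h⟩, rfl⟩
    · rintro ⟨x, hx⟩
      rw [← hx]
      exact Subtype.ext x.2
  obtain ⟨l, hl⟩ := Resolves.extension (e := fun i => e (i + 1)) a b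
    (Submodule.inclusion_injective _) (fun y => (hb y).imp fun _ h => h.1) hab
    (fun y hy => (hb y).imp fun _ h => ⟨h.2 hy, h.1⟩) hK hL' hd hd0 hde hcde
  exact ⟨l + 1, P, _, _, π ∘ₗ f, hce P hP, hπ.comp hf, torsionSurjective_zero (hπ.comp hf), hl⟩

end Resolution

section GroupAlgebra

variable {k G : Type} [Field k] [Group G]

/-- An additive map between modules over a group algebra is linear as soon as it commutes with
scalars and with group elements. -/
def groupAlgebraLinearMap {M N : Type} [AddCommGroup M] [Module (MonoidAlgebra k G) M]
    [AddCommGroup N] [Module (MonoidAlgebra k G) N] (φ : M → N)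
    (hadd : ∀ v w, φ (v + w) = φ v + φ w)
    (hk : ∀ (a : k) (v : M),
      φ (algebraMap k (MonoidAlgebra k G) a • v) = algebraMap k (MonoidAlgebra k G) a • φ v)
    (hG : ∀ (g : G) (v : M), φ (MonoidAlgebra.of k G g • v) = MonoidAlgebra.of k G g • φ v) :
    M →ₗ[MonoidAlgebra k G] N where
  toFun := φ
  map_add' := hadd
  map_smul' a v := by
    induction a using MonoidAlgebra.induction_on generalizing v with
    | of g => exact hG g v
    | add x y hx hy => simp only [add_smul, hadd, hx, hy, RingHom.id_apply]
    | smul r x hx =>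
      simp only [RingHom.id_apply] at hx ⊢
      rw [Algebra.smul_def, mul_smul, mul_smul, hk, hx]

variable (k G) in
/-- Functions on a `G`-set, with the translation action of `G`. -/
def funRep (X : Type) [MulAction G X] : Representation k G (X → k) where
  toFun g := LinearMap.funLeft k k (g⁻¹ • ·)
  map_one' := by ext; simp
  map_mul' g h := by
    refine LinearMap.ext fun f => funext fun x => ?_
    simp [LinearMap.funLeft_apply, mul_smul]

variable (k G) in
/-- The `kG`-module of functions on a `G`-set. -/
abbrev FunModule (X : Type) [MulAction G X] : Type := (funRep k G X).asModule

lemma funModule_of_smul {X : Type} [MulAction G X] (g : G) (f : FunModule k G X) (x : X) :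
    (MonoidAlgebra.of k G g • f : FunModule k G X) x = f (g⁻¹ • x) := by
  rw [MonoidAlgebra.of_apply, Representation.single_smul, one_smul]
  rfl

lemma funModule_algebraMap_smul {X : Type} [MulAction G X] (a : k) (f : FunModule k G X) (x : X) :
    (algebraMap k (MonoidAlgebra k G) a • f : FunModule k G X) x = a * f x := by
  rw [algebraMap_smul]
  rfl

/-- A bijection with a module of functions is a linear equivalence as soon as it is additive and
commutes with scalars and with group elements. -/
noncomputable def equivFunModule {X M : Type} [MulAction G X] [AddCommGroup M]
    [Module (MonoidAlgebra k G) M] (φ : M → X → k) (hφ : Function.Bijective φ)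
    (hadd : ∀ v w x, φ (v + w) x = φ v x + φ w x)
    (hk : ∀ (a : k) (v : M) (x : X), φ (algebraMap k (MonoidAlgebra k G) a • v) x = a * φ v x)
    (hG : ∀ (g : G) (v : M) (x : X), φ (MonoidAlgebra.of k G g • v) x = φ v (g⁻¹ • x)) :
    M ≃ₗ[MonoidAlgebra k G] FunModule k G X :=
  LinearEquiv.ofBijective
    (groupAlgebraLinearMap (N := FunModule k G X) φ (fun v w => funext (hadd v w))
      (fun a v => funext fun x => (hk a v x).trans (funModule_algebraMap_smul a (φ v) x).symm)
      (fun g v => funext fun x => (hG g v x).trans (funModule_of_smul g (φ v) x).symm)) hφ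

/-- On a finite `G`-set, the module of functions is the permutation module. -/
noncomputable def ofMulActionEquivFunModule (X : Type) [Fintype X] [MulAction G X] :
    (Representation.ofMulAction k G X).asModule ≃ₗ[MonoidAlgebra k G] FunModule k G X :=
  equivFunModule (fun v x => ((Representation.ofMulAction k G X).asModuleEquiv v).coeff x)
    ⟨fun v w h => by
      apply (Representation.ofMulAction k G X).asModuleEquiv.injective
      ext x
      exact congrFun h x,
     fun f => ⟨(Representation.ofMulAction k G X).asModuleEquiv.symm
        (.ofCoeff (Finsupp.equivFunOnFinite.symm f)), by funext x; simp⟩⟩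
    (fun v w x => by simp)
    (fun a v x => by rw [algebraMap_smul]; simp)
    (fun g v x => by
      rw [Representation.asModuleEquiv_map_smul, Representation.asAlgebraHom_of,
        Representation.coeff_ofMulAction])

lemma isPermutationModule_of_equiv_funModule {X P : Type} [Finite X] [MulAction G X]
    [AddCommGroup P] [Module (MonoidAlgebra k G) P]
    (e : P ≃ₗ[MonoidAlgebra k G] FunModule k G X) : IsPermutationModule k G P := by
  have := Fintype.ofFinite X
  exact ⟨X, this, _, ⟨e.trans (ofMulActionEquivFunModule X).symm⟩⟩

lemma IsPermutationModule.exists_equiv_funModule {P : Type} [AddCommGroup P]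
    [Module (MonoidAlgebra k G) P] (h : IsPermutationModule k G P) :
    ∃ (X : Type) (_ : Finite X) (_ : MulAction G X),
      Nonempty (P ≃ₗ[MonoidAlgebra k G] FunModule k G X) := by
  obtain ⟨X, _, _, ⟨e⟩⟩ := h
  exact ⟨X, inferInstance, _, ⟨e.trans (ofMulActionEquivFunModule X)⟩⟩

variable (k G) in
/-- Permutation modules on finite free `G`-sets; `s` picks one point in every orbit. -/
def IsFreePermutationModule : ∀ (P : Type) [AddCommGroup P] [Module (MonoidAlgebra k G) P], Prop :=
  fun P _ _ => ∃ (X : Type) (_ : Finite X) (_ : MulAction G X) (Y : Type) (s : Y → X),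
    Function.Bijective (fun w : G × Y => w.1 • s w.2) ∧
      Nonempty (P ≃ₗ[MonoidAlgebra k G] FunModule k G X)

lemma IsFreePermutationModule.isPermutationModule {P : Type} [AddCommGroup P]
    [Module (MonoidAlgebra k G) P] (h : IsFreePermutationModule k G P) :
    IsPermutationModule k G P := by
  obtain ⟨X, _, _, Y, s, -, ⟨e⟩⟩ := h
  exact isPermutationModule_of_equiv_funModule e

/-- Functions on a disjoint union of `G`-sets. -/
noncomputable def funModuleSumEquiv (X X' : Type) [MulAction G X] [MulAction G X'] :
    (FunModule k G X × FunModule k G X') ≃ₗ[MonoidAlgebra k G] FunModule k G (X ⊕ X') :=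
  equivFunModule (fun v => Sum.elim v.1 v.2)
    (Equiv.sumArrowEquivProdArrow X X' k).symm.bijective
    (fun v w x => by rcases x with x | x <;> rfl)
    (fun a v x => by
      rcases x with x | x
      · exact funModule_algebraMap_smul a v.1 x
      · exact funModule_algebraMap_smul a v.2 x)
    (fun g v x => by
      rcases x with x | x
      · exact funModule_of_smul g v.1 x
      · exact funModule_of_smul g v.2 x)

lemma IsPermutationModule.prod {P Q : Type} [AddCommGroup P] [Module (MonoidAlgebra k G) P]
    [AddCommGroup Q] [Module (MonoidAlgebra k G) Q] (hP : IsPermutationModule k G P)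
    (hQ : IsPermutationModule k G Q) : IsPermutationModule k G (P × Q) := by
  obtain ⟨X, _, _, ⟨e⟩⟩ := hP.exists_equiv_funModule
  obtain ⟨X', _, _, ⟨e'⟩⟩ := hQ.exists_equiv_funModule
  exact isPermutationModule_of_equiv_funModule ((e.prodCongr e').trans (funModuleSumEquiv X X'))

lemma IsFreePermutationModule.prod {P Q : Type} [AddCommGroup P] [Module (MonoidAlgebra k G) P]
    [AddCommGroup Q] [Module (MonoidAlgebra k G) Q] (hP : IsFreePermutationModule k G P)
    (hQ : IsFreePermutationModule k G Q) : IsFreePermutationModule k G (P × Q) := by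
  obtain ⟨X, _, _, Y, s, hs, ⟨e⟩⟩ := hP
  obtain ⟨X', _, _, Y', s', hs', ⟨e'⟩⟩ := hQ
  refine ⟨X ⊕ X', inferInstance, inferInstance, Y ⊕ Y', Sum.map s s', ⟨?_, ?_⟩,
    ⟨(e.prodCongr e').trans (funModuleSumEquiv X X')⟩⟩
  · rintro ⟨g, y | y⟩ ⟨h, y' | y'⟩ hw
    · have := hs.1 (a₁ := (g, y)) (a₂ := (h, y')) (by simpa using hw)
      simp_all
    · simp at hw
    · simp at hw
    · have := hs'.1 (a₁ := (g, y)) (a₂ := (h, y')) (by simpa using hw)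
      simp_all
  · rintro (x | x)
    · obtain ⟨⟨g, y⟩, rfl⟩ := hs.2 x
      exact ⟨(g, .inl y), rfl⟩
    · obtain ⟨⟨g, y⟩, rfl⟩ := hs'.2 x
      exact ⟨(g, .inr y), rfl⟩

lemma isFreePermutationModule_punit : IsFreePermutationModule k G PUnit := by
  let _ : MulAction G PEmpty :=
    { smul := fun _ x => x, one_smul := fun _ => rfl, mul_smul := fun _ _ _ => rfl }
  refine ⟨PEmpty, inferInstance, inferInstance, PEmpty, id,
    ⟨fun x => x.2.elim, fun x => x.elim⟩, ⟨LinearEquiv.ofBijective 0 ?_⟩⟩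
  exact ⟨fun _ _ _ => rfl, fun f => ⟨0, funext fun x : PEmpty => x.elim⟩⟩

lemma IsFreePermutationModule.free [Finite G] {P : Type} [AddCommGroup P]
    [Module (MonoidAlgebra k G) P] (h : IsFreePermutationModule k G P) :
    Module.Free (MonoidAlgebra k G) P := by
  obtain ⟨X, _, _, Y, s, hs, ⟨e⟩⟩ := h
  let o : G × Y ≃ X := Equiv.ofBijective _ hs
  have ho : ∀ (g h : G) y, g • o (h, y) = o (g * h, y) := fun g h y => by
    simp [o, mul_smul]
  have hfin : Finite Y := by
    have : Finite (G × Y) := .of_equiv X o.symm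
    exact .of_surjective (Prod.snd : G × Y → Y) Prod.snd_surjective
  have hinv : ∀ g w, o.symm (g⁻¹ • o w) = (g⁻¹ * w.1, w.2) := fun g w => by
    rw [← Prod.mk.eta (p := w), ho, Equiv.symm_apply_apply]
  let E : (Y → MonoidAlgebra k G) ≃ₗ[MonoidAlgebra k G] FunModule k G X :=
    equivFunModule (fun v x => (v (o.symm x).2).coeff (o.symm x).1)
      ⟨fun v w h => by
        ext y g
        simpa using congrFun h (o (g, y)),
       fun f => ⟨fun y => .ofCoeff (Finsupp.equivFunOnFinite.symm fun g => f (o (g, y))), by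
        funext x
        simp⟩⟩
      (fun v w x => by simp)
      (fun a v x => by simp)
      (fun g v x => by
        obtain ⟨w, rfl⟩ := o.surjective x
        rw [hinv]
        simp)
  exact .of_equiv (E.trans e.symm)

end GroupAlgebra

section Transport

variable {k G G' C : Type} [Field k] [CommGroup G] [CommGroup G'] [CommGroup C]

lemma torsionProjective_of_equiv {A : Type} [CommRing A] {z : A} {P Q : Type} [AddCommGroup P]
    [Module A P] [AddCommGroup Q] [Module A Q] (e : P ≃ₗ[A] Q) (h : TorsionProjective z Q) :
    TorsionProjective z P := by
  intro X Y _ _ _ _ f g hf hz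
  obtain ⟨s, hs⟩ := h X Y f (g ∘ₗ e.symm.toLinearMap) hf hz
  refine ⟨s ∘ₗ e.toLinearMap, LinearMap.ext fun x => ?_⟩
  have := LinearMap.congr_fun hs (e x)
  simpa using this

variable (k G) in
/-- The indicator function of a point. -/
def funSingle {X : Type} [DecidableEq X] [MulAction G X] (x : X) : FunModule k G X :=
  (Pi.single x 1 : X → k)

lemma funModule_eq_sum {X : Type} [Fintype X] [DecidableEq X] [MulAction G X]
    (v : FunModule k G X) :
    v = ∑ x, algebraMap k (MonoidAlgebra k G) (v x) • funSingle k G x := by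
  have h (x : X) : algebraMap k (MonoidAlgebra k G) (v x) • funSingle k G x =
      (show FunModule k G X from (Pi.single x (v x) : X → k)) := by
    funext y
    refine (funModule_algebraMap_smul _ _ _).trans ?_
    change v x * (Pi.single x (1 : k) : X → k) y = (Pi.single x (v x) : X → k) y
    rcases eq_or_ne y x with rfl | h
    · rw [Pi.single_eq_same, Pi.single_eq_same, mul_one]
    · rw [Pi.single_eq_of_ne h, Pi.single_eq_of_ne h, mul_zero]
  rw [Fintype.sum_congr _ _ h]
  exact (Finset.univ_sum_single (v : X → k)).symm

lemma of_smul_funSingle {X : Type} [DecidableEq X] [MulAction G X] (g : G) (x : X) :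
    MonoidAlgebra.of k G g • funSingle k G x = funSingle k G (g • x) := by
  funext y
  refine (funModule_of_smul _ _ _).trans ?_
  change (Pi.single x (1 : k) : X → k) (g⁻¹ • y) = (Pi.single (g • x) (1 : k) : X → k) y
  by_cases h : y = g • x
  · rw [h, inv_smul_smul, Pi.single_eq_same, Pi.single_eq_same]
  · rw [Pi.single_eq_of_ne h, Pi.single_eq_of_ne]
    rintro rfl
    simp at h

lemma exists_funModule_lift {X N : Type} [Fintype X] [DecidableEq X] [MulAction G X]
    [AddCommGroup N] [Module (MonoidAlgebra k G) N] (b : X → N)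
    (hb : ∀ g x, b (g • x) = MonoidAlgebra.of k G g • b x) :
    ∃ h : FunModule k G X →ₗ[MonoidAlgebra k G] N, ∀ x, h (funSingle k G x) = b x := by
  refine ⟨groupAlgebraLinearMap
    (fun v => ∑ x, algebraMap k (MonoidAlgebra k G) (v x) • b x) ?_ ?_ ?_, ?_⟩
  · intro v w
    rw [← Finset.sum_add_distrib]
    refine Finset.sum_congr rfl fun x _ => ?_
    rw [← add_smul, ← map_add]
    rfl
  · intro a v
    rw [Finset.smul_sum]
    refine Finset.sum_congr rfl fun x _ => ?_
    rw [funModule_algebraMap_smul, map_mul, mul_smul]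
  · intro g v
    rw [Finset.smul_sum]
    refine Fintype.sum_equiv (MulAction.toPerm g⁻¹) _ _ fun x => ?_
    rw [funModule_of_smul, MulAction.toPerm_apply, smul_comm, ← hb, smul_inv_smul]
  · intro x
    change ∑ y, algebraMap k (MonoidAlgebra k G) ((Pi.single x (1 : k) : X → k) y) • b y = b x
    rw [Finset.sum_eq_single x]
    · rw [Pi.single_eq_same, map_one, one_smul]
    · intro y _ hy
      rw [Pi.single_eq_of_ne hy, map_zero, zero_smul]
    · simp

variable (e : G ≃* C × G')

/-- Inflation of a `kG'`-module along the projection `G ≃ C × G' → G'`. -/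
def InflModule (_ : G ≃* C × G') (W : Type) : Type := W

instance (W : Type) [AddCommGroup W] : AddCommGroup (InflModule e W) :=
  inferInstanceAs (AddCommGroup W)

noncomputable instance (W : Type) [AddCommGroup W] [Module (MonoidAlgebra k G') W] :
    Module (MonoidAlgebra k G) (InflModule e W) :=
  Module.compHom W (MonoidAlgebra.lift k (MonoidAlgebra k G') G
    ((MonoidAlgebra.of k G').comp ((MonoidHom.snd C G').comp e.toMonoidHom))).toRingHom

lemma inflModule_of_smul {W : Type} [AddCommGroup W] [Module (MonoidAlgebra k G') W] (g : G)
    (w : InflModule e W) :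
    MonoidAlgebra.of k G g • w =
      (show InflModule e W from MonoidAlgebra.of k G' (e g).2 • (show W from w)) := by
  change (MonoidAlgebra.lift k (MonoidAlgebra k G') G
    ((MonoidAlgebra.of k G').comp ((MonoidHom.snd C G').comp e.toMonoidHom))
      (MonoidAlgebra.of k G g)) • (show W from w) = _
  rw [MonoidAlgebra.lift_of]
  rfl

lemma inflModule_algebraMap_smul {W : Type} [AddCommGroup W] [Module (MonoidAlgebra k G') W]
    (a : k) (w : InflModule e W) :
    algebraMap k (MonoidAlgebra k G) a • w =
      (show InflModule e W from algebraMap k (MonoidAlgebra k G') a • (show W from w)) := by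
  change (MonoidAlgebra.lift k (MonoidAlgebra k G') G
    ((MonoidAlgebra.of k G').comp ((MonoidHom.snd C G').comp e.toMonoidHom))
      (algebraMap k (MonoidAlgebra k G) a)) • (show W from w) = _
  rw [AlgHom.commutes]

/-- Inflation of linear maps. -/
noncomputable def inflMap {V W : Type} [AddCommGroup V] [Module (MonoidAlgebra k G') V]
    [AddCommGroup W] [Module (MonoidAlgebra k G') W] (f : V →ₗ[MonoidAlgebra k G'] W) :
    InflModule e V →ₗ[MonoidAlgebra k G] InflModule e W :=
  groupAlgebraLinearMap (M := InflModule e V) (N := InflModule e W) (fun v => f v) (f.map_add)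
    (fun a v => (congrArg f (inflModule_algebraMap_smul e a v)).trans
      ((f.map_smul _ _).trans
        (inflModule_algebraMap_smul e a (show InflModule e W from f v)).symm))
    (fun g v => (congrArg f (inflModule_of_smul e g v)).trans
      ((f.map_smul _ _).trans (inflModule_of_smul e g (show InflModule e W from f v)).symm))

/-- The action on `X` of `G`, through the projection to `G'`. -/
abbrev inflAction (X : Type) [MulAction G' X] : MulAction G X :=
  MulAction.compHom X ((MonoidHom.snd C G').comp e.toMonoidHom)

/-- Inflation of modules of functions. -/
noncomputable def inflEquivFunModule {X P : Type} [MulAction G' X] [AddCommGroup P]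
    [Module (MonoidAlgebra k G') P] (φ : P ≃ₗ[MonoidAlgebra k G'] FunModule k G' X) :
    letI := inflAction e X
    InflModule e P ≃ₗ[MonoidAlgebra k G] FunModule k G X :=
  letI := inflAction e X
  equivFunModule (M := InflModule e P) (fun v : P => φ v) φ.bijective
    (fun v w x => congrFun (φ.map_add v w) x)
    (fun a v x => by
      rw [inflModule_algebraMap_smul]
      exact (congrFun (φ.map_smul _ _) x).trans (funModule_algebraMap_smul _ _ _))
    (fun g v x => by
      rw [inflModule_of_smul]
      refine (congrFun (φ.map_smul _ _) x).trans ((funModule_of_smul _ _ _).trans ?_)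
      change _ = φ v ((e g⁻¹).2 • x)
      rw [map_inv]
      rfl)

lemma IsPermutationModule.infl {P : Type} [AddCommGroup P] [Module (MonoidAlgebra k G') P]
    (h : IsPermutationModule k G' P) : IsPermutationModule k G (InflModule e P) := by
  obtain ⟨X, _, _, ⟨φ⟩⟩ := h.exists_equiv_funModule
  let _ := inflAction e X
  exact isPermutationModule_of_equiv_funModule (inflEquivFunModule e φ)

lemma Resolves.infl {n : ℕ} {c : ℕ → ModuleClass (MonoidAlgebra k G')}
    {d : ℕ → ModuleClass (MonoidAlgebra k G)} {W : Type} [AddCommGroup W]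
    [Module (MonoidAlgebra k G') W] (h : Resolves 0 n c W)
    (hcd : ∀ i (P : Type) [AddCommGroup P] [Module (MonoidAlgebra k G') P],
      c i P → d i (InflModule e P)) :
    Resolves 0 n d (InflModule e W) := by
  induction n generalizing c d W with
  | zero => exact h
  | succ n ih =>
    obtain ⟨P, _, _, f, hP, hf, -, hK⟩ := h
    have hf' : Function.Surjective (inflMap e f) := hf
    exact .of_exact (inflMap e (LinearMap.ker f).subtype) (inflMap e f) Subtype.val_injective hf'
      (LinearMap.exact_subtype_ker_map f) (torsionSurjective_zero hf') (hcd 0 P hP)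
      (ih hK fun i => hcd (i + 1))

/-- The `kG`-module induced from a `kG'`-module, where `G ≃ C × G'` and `C` is finite. -/
def IndModule (_ : G ≃* C × G') (W : Type) : Type := C → W

instance (W : Type) [AddCommGroup W] : AddCommGroup (IndModule e W) :=
  inferInstanceAs (AddCommGroup (C → W))

/-- Translation of functions on `C`. -/
def translationRep (R C W : Type) [CommRing R] [CommGroup C] [AddCommGroup W] [Module R W] :
    Representation R C (C → W) where
  toFun c := LinearMap.funLeft R W (c⁻¹ * ·)
  map_one' := by
    refine LinearMap.ext fun f => funext fun x => ?_
    simp [LinearMap.funLeft_apply]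
  map_mul' c d := by
    refine LinearMap.ext fun f => funext fun x => ?_
    simp only [LinearMap.funLeft_apply, Module.End.mul_apply, mul_inv_rev, mul_assoc]

variable (k) in
/-- The isomorphism `G ≃ C × G'` as a map to units of the algebra `(kG')[C]`. -/
noncomputable def splitHom : G →* MonoidAlgebra (MonoidAlgebra k G') C where
  toFun g := MonoidAlgebra.single (e g).1 (MonoidAlgebra.of k G' (e g).2)
  map_one' := by simp; rfl
  map_mul' g h := by
    rw [MonoidAlgebra.single_mul_single, ← map_mul, map_mul e]
    rfl

variable (k) in
/-- The action of `kG` on the induced module. -/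
noncomputable def indHom (W : Type) [AddCommGroup W] [Module (MonoidAlgebra k G') W] :
    MonoidAlgebra k G →+* Module.End (MonoidAlgebra k G') (C → W) :=
  (translationRep (MonoidAlgebra k G') C W).asAlgebraHom.toRingHom.comp
    (MonoidAlgebra.lift k (MonoidAlgebra (MonoidAlgebra k G') C) G (splitHom k e)).toRingHom

noncomputable instance (W : Type) [AddCommGroup W] [Module (MonoidAlgebra k G') W] :
    Module (MonoidAlgebra k G) (IndModule e W) :=
  Module.compHom (C → W) (indHom k e W)

lemma indModule_of_smul {W : Type} [AddCommGroup W] [Module (MonoidAlgebra k G') W] (g : G)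
    (f : IndModule e W) (c : C) :
    (MonoidAlgebra.of k G g • f) c = MonoidAlgebra.of k G' (e g).2 • f ((e g).1⁻¹ * c) := by
  change (translationRep (MonoidAlgebra k G') C W).asAlgebraHom
    (MonoidAlgebra.lift k (MonoidAlgebra (MonoidAlgebra k G') C) G (splitHom k e)
      (MonoidAlgebra.of k G g)) (f : C → W) c = _
  rw [MonoidAlgebra.lift_of]
  change (translationRep (MonoidAlgebra k G') C W).asAlgebraHom (MonoidAlgebra.single _ _) _ _ = _
  rw [Representation.asAlgebraHom_single]
  rfl

lemma indModule_algebraMap_smul {W : Type} [AddCommGroup W] [Module (MonoidAlgebra k G') W]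
    (a : k) (f : IndModule e W) (c : C) :
    (algebraMap k (MonoidAlgebra k G) a • f) c = algebraMap k (MonoidAlgebra k G') a • f c := by
  change (translationRep (MonoidAlgebra k G') C W).asAlgebraHom
    (MonoidAlgebra.lift k (MonoidAlgebra (MonoidAlgebra k G') C) G (splitHom k e)
      (algebraMap k (MonoidAlgebra k G) a)) (f : C → W) c = _
  rw [AlgHom.commutes, IsScalarTower.algebraMap_apply k (MonoidAlgebra k G'), AlgHom.commutes]
  rfl

/-- Induction of linear maps. -/
noncomputable def indMap {V W : Type} [AddCommGroup V] [Module (MonoidAlgebra k G') V]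
    [AddCommGroup W] [Module (MonoidAlgebra k G') W] (f : V →ₗ[MonoidAlgebra k G'] W) :
    IndModule e V →ₗ[MonoidAlgebra k G] IndModule e W :=
  groupAlgebraLinearMap (M := IndModule e V) (N := IndModule e W) (fun v c => f (v c))
    (fun v w => funext fun c => f.map_add (v c) (w c))
    (fun a v => funext fun c => (congrArg f (indModule_algebraMap_smul e a v c)).trans
      ((f.map_smul _ _).trans
        (indModule_algebraMap_smul e a (show IndModule e W from fun c => f (v c)) c).symm))
    (fun g v => funext fun c => (congrArg f (indModule_of_smul e g v c)).trans
      ((f.map_smul _ _).trans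
        (indModule_of_smul e g (show IndModule e W from fun c => f (v c)) c).symm))

/-- The action of `G ≃ C × G'` on `C × X`. -/
abbrev indAction (X : Type) [MulAction G' X] : MulAction G (C × X) where
  smul g w := ((e g).1 * w.1, (e g).2 • w.2)
  one_smul w := by
    change ((e 1).1 * w.1, (e 1).2 • w.2) = w
    simp
  mul_smul g h w := by
    change ((e (g * h)).1 * w.1, (e (g * h)).2 • w.2) =
      ((e g).1 * ((e h).1 * w.1), (e g).2 • (e h).2 • w.2)
    simp [mul_smul, mul_assoc]

/-- Induction of modules of functions. -/
noncomputable def indEquivFunModule {X P : Type} [MulAction G' X] [AddCommGroup P]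
    [Module (MonoidAlgebra k G') P] (φ : P ≃ₗ[MonoidAlgebra k G'] FunModule k G' X) :
    letI := indAction e X
    IndModule e P ≃ₗ[MonoidAlgebra k G] FunModule k G (C × X) :=
  letI := indAction e X
  equivFunModule (M := IndModule e P) (fun v w => φ (v w.1) w.2)
    ⟨fun v v' h => funext fun c => φ.injective (funext fun x => congrFun h (c, x)),
      fun f => ⟨fun c => φ.symm fun x => f (c, x), 
        funext fun w => congrFun (φ.apply_symm_apply _) w.2⟩⟩
    (fun v w x => congrFun (φ.map_add (v x.1) (w x.1)) x.2)
    (fun a v x => by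
      rw [indModule_algebraMap_smul, map_smul, funModule_algebraMap_smul])
    (fun g v x => by
      rw [indModule_of_smul, map_smul, funModule_of_smul]
      change _ = φ (v ((e g⁻¹).1 * x.1)) ((e g⁻¹).2 • x.2)
      rw [map_inv]
      rfl)

lemma IsPermutationModule.ind [Finite C] {P : Type} [AddCommGroup P]
    [Module (MonoidAlgebra k G') P] (h : IsPermutationModule k G' P) :
    IsPermutationModule k G (IndModule e P) := by
  obtain ⟨X, _, _, ⟨φ⟩⟩ := h.exists_equiv_funModule
  let _ := indAction e X
  exact isPermutationModule_of_equiv_funModule (indEquivFunModule e φ)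

lemma IsFreePermutationModule.ind [Finite C] {P : Type} [AddCommGroup P]
    [Module (MonoidAlgebra k G') P] (h : IsFreePermutationModule k G' P) :
    IsFreePermutationModule k G (IndModule e P) := by
  obtain ⟨X, _, _, Y, s, hs, ⟨φ⟩⟩ := h
  let _ := indAction e X
  refine ⟨C × X, inferInstance, inferInstance, Y, fun y => (1, s y), ⟨?_, ?_⟩,
    ⟨indEquivFunModule e φ⟩⟩
  · rintro ⟨g, y⟩ ⟨h, y'⟩ hw
    have h1 : (e g).1 * 1 = (e h).1 * 1 := congrArg Prod.fst hw
    have h2 : (e g).2 • s y = (e h).2 • s y' := congrArg Prod.snd hw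
    have h3 := hs.1 (a₁ := ((e g).2, y)) (a₂ := ((e h).2, y')) h2
    have h4 : (e g).2 = (e h).2 := congrArg Prod.fst h3
    have h5 : y = y' := congrArg Prod.snd h3
    have h6 : e g = e h := Prod.ext (by simpa using h1) h4
    exact Prod.ext (e.injective h6) h5
  · rintro ⟨c, x⟩
    obtain ⟨⟨g, y⟩, rfl⟩ := hs.2 x
    refine ⟨(e.symm (c, g), y), ?_⟩
    change ((e (e.symm (c, g))).1 * 1, (e (e.symm (c, g))).2 • s y) = _
    simp

lemma Resolves.ind {z : MonoidAlgebra k G} {n : ℕ} {c : ℕ → ModuleClass (MonoidAlgebra k G')}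
    {d : ℕ → ModuleClass (MonoidAlgebra k G)} {W : Type} [AddCommGroup W]
    [Module (MonoidAlgebra k G') W] (h : Resolves 0 n c W)
    (hz : ∀ (P V : Type) [AddCommGroup P] [Module (MonoidAlgebra k G') P] [AddCommGroup V]
      [Module (MonoidAlgebra k G') V] (f : P →ₗ[MonoidAlgebra k G'] V),
      Function.Surjective f → TorsionSurjective z (indMap e f))
    (hcd : ∀ i (P : Type) [AddCommGroup P] [Module (MonoidAlgebra k G') P],
      c i P → d i (IndModule e P)) :
    Resolves z n d (IndModule e W) := by
  induction n generalizing c d W with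
  | zero =>
    have : Subsingleton W := h
    exact inferInstanceAs (Subsingleton (C → W))
  | succ n ih =>
    obtain ⟨P, _, _, f, hP, hf, -, hK⟩ := h
    refine .of_exact (indMap e (LinearMap.ker f).subtype) (indMap e f)
      (fun v w h => funext fun x => Subtype.ext (congrFun h x))
      (fun v => ⟨fun x => (hf (v x)).choose, funext fun x => (hf (v x)).choose_spec⟩)
      (fun v => ⟨fun h => ⟨fun x => ⟨v x, congrFun h x⟩, rfl⟩, ?_⟩) (hz _ _ f hf) (hcd 0 P hP)
      (ih hK fun i => hcd (i + 1))
    rintro ⟨w, rfl⟩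
    exact funext fun x => (w x).2

end Transport

section Split

variable {p : ℕ} {k G G' : Type} [Field k] [CommGroup G] [CommGroup G']
  (e : G ≃* Multiplicative (ZMod p) × G')

variable (k) in
/-- The element `σ - 1` of the group algebra, where `σ` is the generator of the cyclic factor. -/
noncomputable def splitElement : MonoidAlgebra k G :=
  MonoidAlgebra.of k G (e.symm (Multiplicative.ofAdd 1, 1)) - 1

lemma exists_pow_ofAdd_one [NeZero p] (c : Multiplicative (ZMod p)) :
    ∃ n : ℕ, Multiplicative.ofAdd (1 : ZMod p) ^ n = c :=
  ⟨c.toAdd.val, by rw [← ofAdd_nsmul, nsmul_one, ZMod.natCast_zmod_val]; rfl⟩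

lemma of_smul_eq_self_of_splitElement_smul [NeZero p] {N : Type} [AddCommGroup N]
    [Module (MonoidAlgebra k G) N] {x : N} (hx : splitElement k e • x = 0)
    (c : Multiplicative (ZMod p)) : MonoidAlgebra.of k G (e.symm (c, 1)) • x = x := by
  have h1 : MonoidAlgebra.of k G (e.symm (Multiplicative.ofAdd 1, 1)) • x = x := by
    rwa [splitElement, sub_smul, one_smul, sub_eq_zero] at hx
  obtain ⟨n, rfl⟩ := exists_pow_ofAdd_one c
  induction n with
  | zero =>
    rw [pow_zero, ← Prod.one_eq_mk, map_one, map_one, one_smul]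
  | succ n ih =>
    have : ((Multiplicative.ofAdd (1 : ZMod p)) ^ (n + 1), (1 : G')) =
        (Multiplicative.ofAdd 1 ^ n, 1) * (Multiplicative.ofAdd 1, 1) := by
      rw [Prod.mk_mul_mk, pow_succ, one_mul]
    rw [this, map_mul, map_mul, mul_smul, h1, ih]

lemma splitElement_smul_indModule {W : Type} [AddCommGroup W] [Module (MonoidAlgebra k G') W]
    (f : IndModule e W) (c : Multiplicative (ZMod p)) :
    (splitElement k e • f) c = f ((Multiplicative.ofAdd 1)⁻¹ * c) - f c := by
  rw [splitElement, sub_smul, one_smul]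
  change (MonoidAlgebra.of k G (e.symm (Multiplicative.ofAdd 1, 1)) • f) c - f c = _
  rw [indModule_of_smul, MulEquiv.apply_symm_apply, map_one, one_smul]

lemma splitElement_smul_indModule_eq_zero_iff [NeZero p] {W : Type} [AddCommGroup W]
    [Module (MonoidAlgebra k G') W] (f : IndModule e W) :
    splitElement k e • f = 0 ↔ ∀ c, f c = f 1 := by
  constructor
  · intro h c
    obtain ⟨n, rfl⟩ := exists_pow_ofAdd_one c
    induction n with
    | zero => rw [pow_zero]
    | succ n ih =>
      have h1 : f ((Multiplicative.ofAdd 1)⁻¹ * Multiplicative.ofAdd 1 ^ (n + 1)) -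
          f (Multiplicative.ofAdd 1 ^ (n + 1)) = (0 : W) :=
        (splitElement_smul_indModule e f _).symm.trans (congrFun h _)
      have h2 : (Multiplicative.ofAdd (1 : ZMod p))⁻¹ * Multiplicative.ofAdd 1 ^ (n + 1) =
          Multiplicative.ofAdd 1 ^ n := by
        rw [pow_succ', inv_mul_cancel_left]
      exact (sub_eq_zero.1 h1).symm.trans ((congrArg f h2).trans ih)
  · intro h
    funext c
    rw [splitElement_smul_indModule, h, h c, sub_self]
    rfl

lemma torsionSurjective_indMap [NeZero p] {V W : Type} [AddCommGroup V]
    [Module (MonoidAlgebra k G') V] [AddCommGroup W] [Module (MonoidAlgebra k G') W]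
    {f : V →ₗ[MonoidAlgebra k G'] W} (hf : Function.Surjective f) :
    TorsionSurjective (splitElement k e) (indMap e f) := by
  intro w hw
  rw [splitElement_smul_indModule_eq_zero_iff] at hw
  obtain ⟨v, hv⟩ := hf (w 1)
  refine ⟨fun _ => v, (splitElement_smul_indModule_eq_zero_iff e _).2 fun _ => rfl, ?_⟩
  funext c
  exact hv.trans (hw c).symm

lemma IsFreePermutationModule.torsionProjective_infl [NeZero p] {P : Type} [AddCommGroup P]
    [Module (MonoidAlgebra k G') P] (hP : IsFreePermutationModule k G' P) :
    TorsionProjective (splitElement k e) (InflModule e P) := by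
  classical
  obtain ⟨X, _, _, Y, s, hs, ⟨φ⟩⟩ := hP
  have := Fintype.ofFinite X
  let _ := inflAction e X
  have hsmul (g : G) (x : X) : g • x = (e g).2 • x := rfl
  refine torsionProjective_of_equiv (inflEquivFunModule e φ) ?_
  intro M N _ _ _ _ f g hf hz
  have hfix (x : X) : splitElement k e • funSingle k G x = 0 := by
    rw [splitElement, sub_smul, one_smul, of_smul_funSingle, hsmul, MulEquiv.apply_symm_apply,
      one_smul, sub_self]
  have hlift (y : Y) := hz (g (funSingle k G (s y))) (by rw [← map_smul, hfix, map_zero])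
  choose ξ hξz hξ using hlift
  let o : G' × Y ≃ X := Equiv.ofBijective _ hs
  have ho (w : G' × Y) : o w = w.1 • s w.2 := rfl
  obtain ⟨h, hh⟩ := exists_funModule_lift (k := k) (G := G)
    (fun x => MonoidAlgebra.of k G (e.symm (1, (o.symm x).1)) • ξ (o.symm x).2) (by
      intro g x
      obtain ⟨⟨a, y⟩, rfl⟩ := o.surjective x
      have h1 : g • o (a, y) = o ((e g).2 * a, y) := by
        rw [hsmul, ho, ho, mul_smul]
      have h2 : g * e.symm (1, a) = e.symm (1, (e g).2 * a) * e.symm ((e g).1, 1) := by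
        apply e.injective
        simp only [map_mul, MulEquiv.apply_symm_apply]
        ext <;> simp
      rw [h1, Equiv.symm_apply_apply, Equiv.symm_apply_apply, ← mul_smul, ← map_mul, h2, map_mul,
        mul_smul, of_smul_eq_self_of_splitElement_smul e (hξz y)])
  refine ⟨h, LinearMap.ext fun v => ?_⟩
  have hsingle (x : X) : f (h (funSingle k G x)) = g (funSingle k G x) := by
    obtain ⟨⟨a, y⟩, rfl⟩ := o.surjective x
    rw [hh, Equiv.symm_apply_apply, map_smul, hξ, ← map_smul, of_smul_funSingle, hsmul,
      MulEquiv.apply_symm_apply, ho]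
  rw [funModule_eq_sum v, LinearMap.comp_apply, map_sum, map_sum, map_sum]
  exact Finset.sum_congr rfl fun x _ => by rw [map_smul, map_smul, map_smul, hsingle]

end Split

section TrivialModule

variable {p : ℕ} {k G G' : Type} [Field k] [CommGroup G] [CommGroup G']
  (e : G ≃* Multiplicative (ZMod p) × G')

variable (k G) in
/-- The trivial module. -/
abbrev TrivialModule : Type := FunModule k G PUnit

variable (k) in
/-- The trivial module as the submodule of constant functions in the induced module. -/
noncomputable def constMap :
    TrivialModule k G →ₗ[MonoidAlgebra k G] IndModule e (TrivialModule k G') :=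
  groupAlgebraLinearMap (M := TrivialModule k G) (N := IndModule e (TrivialModule k G'))
    (fun v _ => (show PUnit → k from v)) (fun _ _ => rfl)
    (fun a v => funext fun c => funext fun u => (funModule_algebraMap_smul a v u).trans
      ((congrFun (indModule_algebraMap_smul e a
        (show IndModule e (TrivialModule k G') from fun _ => (show PUnit → k from v)) c) u).trans
          (funModule_algebraMap_smul (G := G') a _ u)).symm)
    (fun g v => funext fun c => funext fun u => (funModule_of_smul g v u).trans
      ((congrFun (indModule_of_smul e g
        (show IndModule e (TrivialModule k G') from fun _ => (show PUnit → k from v)) c) u).trans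
          (funModule_of_smul (G := G') _ _ u)).symm)

variable (k) in
/-- The trivial module as the quotient of the induced module by summing values. -/
noncomputable def sumMap [NeZero p] :
    IndModule e (TrivialModule k G') →ₗ[MonoidAlgebra k G] TrivialModule k G :=
  groupAlgebraLinearMap (M := IndModule e (TrivialModule k G')) (N := TrivialModule k G)
    (fun f u => ∑ c, (f c : PUnit → k) u)
    (fun v w => funext fun u => Finset.sum_add_distrib)
    (fun a v => funext fun u => by
      refine (Fintype.sum_congr _ _ fun c => (congrFun (indModule_algebraMap_smul e a v c) u).trans
        (funModule_algebraMap_smul (G := G') a _ u)).trans ?_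
      refine Eq.trans ?_ (funModule_algebraMap_smul (G := G) a _ u).symm
      exact (Finset.mul_sum _ _ _).symm)
    (fun g v => funext fun u => by
      refine (Fintype.sum_congr _ _ fun c => (congrFun (indModule_of_smul e g v c) u).trans
        (funModule_of_smul (G := G') _ _ u)).trans ?_
      refine Eq.trans ?_ (funModule_of_smul (G := G) g _ u).symm
      exact Fintype.sum_equiv (Equiv.mulLeft (e g).1⁻¹) _ _ fun c => rfl)

lemma constMap_injective [NeZero p] : Function.Injective (constMap k e) := fun _ _ h =>
  congrFun h 1

lemma sumMap_surjective [NeZero p] : Function.Surjective (sumMap k e) := by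
  intro v
  refine ⟨(Pi.single 1 (show TrivialModule k G' from (v : PUnit → k)) :
    Multiplicative (ZMod p) → TrivialModule k G'), funext fun u => ?_⟩
  change ∑ c, ((Pi.single 1 (show TrivialModule k G' from (v : PUnit → k)) :
    Multiplicative (ZMod p) → TrivialModule k G') c : PUnit → k) u = (v : PUnit → k) u
  rw [Finset.sum_eq_single 1]
  · rw [Pi.single_eq_same]
  · intro c _ hc
    rw [Pi.single_eq_of_ne hc]
    rfl
  · simp

lemma exists_sub_eq_of_sum_eq_zero [NeZero p] (a : ZMod p → k) (ha : ∑ i, a i = 0) :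
    ∃ h : ZMod p → k, ∀ i, h (-1 + i) - h i = a i := by
  have hp : 0 < p := NeZero.pos p
  have ha' : ∑ j ∈ Finset.range p, a j = 0 := by
    rw [← ha]
    exact Finset.sum_bij' (fun j _ => (j : ZMod p)) (fun i _ => i.val) (by simp)
      (fun i _ => Finset.mem_range.2 i.val_lt)
      (fun j hj => ZMod.val_cast_of_lt (Finset.mem_range.1 hj))
      (fun i _ => ZMod.natCast_zmod_val i) (fun _ _ => rfl)
  refine ⟨fun i => -∑ j ∈ Finset.range (i.val + 1), a j, fun i => ?_⟩
  obtain ⟨n, hn, rfl⟩ : ∃ n < p, i = ((n + 1 : ℕ) : ZMod p) :=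
    ⟨(-1 + i).val, ZMod.val_lt _, by push_cast; rw [ZMod.natCast_zmod_val]; ring⟩
  have h1 : (-1 + ((n + 1 : ℕ) : ZMod p)) = n := by push_cast; ring
  beta_reduce
  rw [h1, ZMod.val_cast_of_lt hn]
  rcases Nat.lt_or_eq_of_le (Nat.succ_le_of_lt hn) with h | h
  · rw [ZMod.val_cast_of_lt h, Finset.sum_range_succ _ (n + 1)]
    ring
  · have h2 : ((n + 1 : ℕ) : ZMod p) = 0 := by rw [show n + 1 = p from h, ZMod.natCast_self]
    rw [h2, show n + 1 = p from h, ha', ZMod.val_zero]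
    simp

lemma exact_constMap [NeZero p] : Function.Exact (constMap k e)
    (splitElement k e • LinearMap.id :
      IndModule e (TrivialModule k G') →ₗ[MonoidAlgebra k G] _) := by
  intro f
  refine (splitElement_smul_indModule_eq_zero_iff e f).trans ⟨fun h => ?_, ?_⟩
  · exact ⟨(show PUnit → k from f 1), funext fun c => (h c).symm⟩
  · rintro ⟨v, rfl⟩ c
    rfl

lemma exact_sumMap [NeZero p] : Function.Exact
    (splitElement k e • LinearMap.id :
      IndModule e (TrivialModule k G') →ₗ[MonoidAlgebra k G] _) (sumMap k e) := by
  intro f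
  constructor
  · intro h
    obtain ⟨b, hb⟩ := exists_sub_eq_of_sum_eq_zero
      (fun i => (f (Multiplicative.ofAdd i) : PUnit → k) PUnit.unit)
      ((Fintype.sum_equiv Multiplicative.ofAdd _ _ fun _ => rfl).trans (congrFun h PUnit.unit))
    refine ⟨fun c _ => b c.toAdd, funext fun c => ?_⟩
    refine (splitElement_smul_indModule (k := k) e _ c).trans (funext fun u => ?_)
    exact hb c.toAdd
  · rintro ⟨h, rfl⟩
    refine (map_smul (sumMap k e) (splitElement k e) h).trans ?_
    rw [splitElement, sub_smul, one_smul, sub_eq_zero]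
    exact funext fun u => funModule_of_smul _ _ _

end TrivialModule

section Stages

variable {p : ℕ} {k G G' : Type} [Field k] [CommGroup G] [CommGroup G']

variable (k G) in
/-- Permutation modules, required to be free in degrees less than `m`. -/
def freeClass (m : ℕ) : ℕ → ModuleClass (MonoidAlgebra k G) := fun i P _ _ =>
  IsPermutationModule k G P ∧ (i < m → IsFreePermutationModule k G P)

/-- Permutation modules, required to be free in degrees less than `min j m`, and projective relative
to maps which are surjective on `z`-torsion in degrees less than `m`. -/
def stageClass (z : MonoidAlgebra k G) (j m : ℕ) : ℕ → ModuleClass (MonoidAlgebra k G) :=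
  fun i P _ _ => IsPermutationModule k G P ∧ (i < j → i < m → IsFreePermutationModule k G P) ∧
    (i < m → TorsionProjective z P)

lemma IsFreePermutationModule.torsionProjective [Finite G] {P : Type} [AddCommGroup P]
    [Module (MonoidAlgebra k G) P] (h : IsFreePermutationModule k G P) (z : MonoidAlgebra k G) :
    TorsionProjective z P :=
  have := h.free
  .of_projective z P

lemma freeClass_punit (m i : ℕ) : freeClass k G m i PUnit :=
  ⟨isFreePermutationModule_punit.isPermutationModule, fun _ => isFreePermutationModule_punit⟩

lemma freeClass.prod {m i : ℕ} {P Q : Type} [AddCommGroup P] [Module (MonoidAlgebra k G) P]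
    [AddCommGroup Q] [Module (MonoidAlgebra k G) Q] (hP : freeClass k G m i P)
    (hQ : freeClass k G m i Q) : freeClass k G m i (P × Q) :=
  ⟨hP.1.prod hQ.1, fun h => (hP.2 h).prod (hQ.2 h)⟩

lemma freeClass.stageClass [Finite G] {m i : ℕ} {P : Type} [AddCommGroup P]
    [Module (MonoidAlgebra k G) P] (hP : freeClass k G m i P) (z : MonoidAlgebra k G) (j : ℕ) :
    stageClass z j m i P :=
  ⟨hP.1, fun _ h => hP.2 h, fun h => (hP.2 h).torsionProjective z⟩

lemma exists_resolves_range [Finite G] [NeZero p] (e : G ≃* Multiplicative (ZMod p) × G')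
    (hT : ∀ m, ∃ n, Resolves 0 n (freeClass k G' m) (TrivialModule k G'))
    {L N : Type} [AddCommGroup L] [Module (MonoidAlgebra k G) L] [AddCommGroup N]
    [Module (MonoidAlgebra k G) N] (ι : L →ₗ[MonoidAlgebra k G] IndModule e (TrivialModule k G'))
    (π : IndModule e (TrivialModule k G') →ₗ[MonoidAlgebra k G] N)
    (hι : Function.Injective ι) (hπ : Function.Surjective π) (hex : Function.Exact ι π) {j : ℕ}
    (hL : ∀ m, ∃ n, Resolves 0 n (stageClass (splitElement k e) j m) L) (m : ℕ) :
    ∃ n, Resolves 0 n (stageClass (splitElement k e) (j + 1) m) N := by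
  obtain ⟨n, hn⟩ := hT m
  have hM : Resolves (splitElement k e) n (freeClass k G m) (IndModule e (TrivialModule k G')) :=
    hn.ind e (fun _ _ _ _ _ _ _ hf => torsionSurjective_indMap e hf)
      fun i P _ _ hP => ⟨hP.1.ind e, fun h => (hP.2 h).ind e⟩
  obtain ⟨n', hn'⟩ := hL (max m n)
  refine Resolves.quotient ι π hι hπ hex (hM.succ (freeClass_punit m)) hn'
    (fun i hi Q _ _ hQ => hQ.2.2 (lt_max_of_lt_right hi))
    (fun i => (freeClass_punit _ i).stageClass _ _) (fun P _ _ hP => hP.stageClass _ _)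
    (fun i Q _ _ hQ => ⟨hQ.1, fun h h' => ?_, fun h => ?_⟩)
    (fun i P Q _ _ _ _ hP hQ => ⟨hP.1.prod hQ.1, fun h h' => ?_, fun h => ?_⟩)
  · exact hQ.2.1 (by omega) (by omega)
  · exact hQ.2.2 (by omega)
  · exact (hP.2 h').prod (hQ.2.1 (by omega) (by omega))
  · exact ((hP.2 h).torsionProjective _).prod (hQ.2.2 (by omega))

/-- The trivial module is isomorphic to the inflation of the trivial module. -/
noncomputable def inflTrivialModuleEquiv {C : Type} [CommGroup C] (e : G ≃* C × G') :
    InflModule e (TrivialModule k G') ≃ₗ[MonoidAlgebra k G] TrivialModule k G :=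
  inflEquivFunModule e (LinearEquiv.refl (MonoidAlgebra k G') (TrivialModule k G'))

lemma exists_resolves_trivialModule_of_split [Finite G] [NeZero p]
    (e : G ≃* Multiplicative (ZMod p) × G')
    (hT : ∀ m, ∃ n, Resolves 0 n (freeClass k G' m) (TrivialModule k G')) (m : ℕ) :
    ∃ n, Resolves 0 n (freeClass k G m) (TrivialModule k G) := by
  have key (j : ℕ) : ∀ m, ∃ n,
      Resolves 0 n (stageClass (splitElement k e) (2 * j) m) (TrivialModule k G) := by
    induction j with
    | zero =>
      intro m
      obtain ⟨n, hn⟩ := hT m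
      exact ⟨n, (hn.infl (d := stageClass (splitElement k e) 0 m) e fun i P _ _ hP =>
        ⟨hP.1.infl e, fun h => absurd h i.not_lt_zero, fun h => (hP.2 h).torsionProjective_infl e⟩
        ).of_equiv (inflTrivialModuleEquiv e)⟩
    | succ j ih =>
      let μ : IndModule e (TrivialModule k G') →ₗ[MonoidAlgebra k G]
        IndModule e (TrivialModule k G') := splitElement k e • LinearMap.id
      have h1 := exists_resolves_range e hT (constMap k e) μ.rangeRestrict
        (constMap_injective e) μ.surjective_rangeRestrict
        (fun x => (Subtype.ext_iff).trans (exact_constMap e x)) ih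
      refine exists_resolves_range e hT (LinearMap.range μ).subtype (sumMap k e)
        Subtype.val_injective (sumMap_surjective e)
        (fun x => (exact_sumMap e x).trans ⟨fun h => ⟨⟨x, h⟩, rfl⟩, ?_⟩) h1
      rintro ⟨y, rfl⟩
      exact y.2
  obtain ⟨n, hn⟩ := key m m
  exact ⟨n, hn.mono fun i P _ _ hP => ⟨hP.1, fun h => hP.2.1 (by omega) h⟩⟩

lemma resolves_trivialModule_of_subsingleton [Subsingleton G] (m : ℕ) :
    Resolves 0 1 (freeClass k G m) (TrivialModule k G) := by
  have h : IsFreePermutationModule k G (TrivialModule k G) :=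
    ⟨PUnit, inferInstance, inferInstance, PUnit, id,
      ⟨fun a b _ => Subsingleton.elim a b, fun x => ⟨(1, x), rfl⟩⟩, ⟨LinearEquiv.refl _ _⟩⟩
  refine ⟨TrivialModule k G, _, _, LinearMap.id, ⟨h.isPermutationModule, fun _ => h⟩,
    Function.surjective_id, torsionSurjective_zero Function.surjective_id, ?_⟩
  rw [LinearMap.ker_id]
  exact inferInstanceAs (Subsingleton (⊥ : Submodule _ _))

/-- Splitting off the first factor of a power of a group. -/
def finSuccMulEquiv (C : Type) [CommGroup C] (r : ℕ) : (Fin (r + 1) → C) ≃* C × (Fin r → C) where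
  toFun f := (f 0, fun i => f i.succ)
  invFun w := Fin.cons w.1 w.2
  left_inv f := by
    funext i
    refine Fin.cases ?_ (fun i => ?_) i <;> simp
  right_inv w := by ext <;> simp
  map_mul' f g := rfl

theorem exists_resolves_trivialModule [NeZero p] (r m : ℕ) :
    ∃ n, Resolves 0 n (freeClass k (Fin r → Multiplicative (ZMod p)) m)
      (TrivialModule k (Fin r → Multiplicative (ZMod p))) := by
  induction r generalizing m with
  | zero => exact ⟨1, resolves_trivialModule_of_subsingleton m⟩
  | succ r ih =>
    exact exists_resolves_trivialModule_of_split (finSuccMulEquiv (Multiplicative (ZMod p)) r) ih m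

end Stages

section Conclusion

lemma Resolves.exists_complex {A : Type} [CommRing A] {z : A} {n : ℕ} {c : ℕ → ModuleClass A}
    {M : Type} [AddCommGroup M] [Module A M] (h : Resolves z n c M) (hc : ∀ i, c i PUnit) :
    ∃ (P : ℕ → ModuleCat.{0} A) (d : ∀ i, P (i + 1) ⟶ P i) (ε : P 0 ⟶ ModuleCat.of A M),
      (∀ i, c i (P i)) ∧ (∀ i, n ≤ i → Subsingleton (P i)) ∧ Function.Surjective ε ∧
        Function.Exact (d 0) ε ∧ ∀ i, Function.Exact (d (i + 1)) (d i) := by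
  induction n generalizing c M with
  | zero =>
    have : Subsingleton M := h
    refine ⟨fun _ => ModuleCat.of A PUnit, fun _ => 0, 0, hc,
      fun _ _ => inferInstanceAs (Subsingleton PUnit), fun y => ⟨0, Subsingleton.elim (α := M) _ _⟩,
      fun x => ?_, fun _ x => ?_⟩
    · exact ⟨fun _ => ⟨0, Subsingleton.elim (α := PUnit) _ _⟩,
        fun _ => Subsingleton.elim (α := M) _ _⟩
    · exact ⟨fun _ => ⟨0, Subsingleton.elim (α := PUnit) _ _⟩,
        fun _ => Subsingleton.elim (α := PUnit) _ _⟩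
  | succ n ih =>
    obtain ⟨P₀, _, _, f, hP, hf, -, hK⟩ := h
    obtain ⟨P, d, ε, hPc, hPn, hε, hdε, hdd⟩ := ih hK fun i => hc (i + 1)
    let ι : P 0 ⟶ ModuleCat.of A P₀ := ε ≫ ModuleCat.ofHom (LinearMap.ker f).subtype
    have hι (x : P 0) : ι x = (ε x : LinearMap.ker f).1 := rfl
    refine ⟨fun i => Nat.casesOn i (ModuleCat.of A P₀) P,
      fun i => Nat.casesOn i ι d, ModuleCat.ofHom f, ?_, ?_, hf, ?_, ?_⟩
    · rintro (_ | i)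
      · exact hP
      · exact hPc i
    · rintro (_ | i) hi
      · omega
      · exact hPn i (by omega)
    · intro x
      change f x = 0 ↔ ∃ y, ι y = x
      constructor
      · intro hx
        obtain ⟨y, hy⟩ := hε ⟨x, hx⟩
        exact ⟨y, congrArg Subtype.val hy⟩
      · rintro ⟨y, rfl⟩
        exact (ε y : LinearMap.ker f).2
    · rintro (_ | i)
      · intro x
        change ι x = 0 ↔ ∃ y, d 0 y = x
        refine Iff.trans ?_ (hdε x)
        exact (Subtype.ext_iff (a1 := (ε x : LinearMap.ker f)) (a2 := 0)).symm
      · exact hdd i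

variable {p : ℕ} {k G : Type} [Field k] [CommGroup G]

lemma of_sub_one_mem_of_isPrime [Fact p.Prime] [CharP k p] (hG : ∀ g : G, g ^ p = 1)
    (I : Ideal (MonoidAlgebra k G)) [I.IsPrime] (g : G) : MonoidAlgebra.of k G g - 1 ∈ I := by
  have : CharP (MonoidAlgebra k G) p :=
    charP_of_injective_algebraMap (FaithfulSMul.algebraMap_injective k (MonoidAlgebra k G)) p
  refine Ideal.IsPrime.mem_of_pow_mem ‹_› p ?_
  rw [sub_pow_char, ← map_pow, hG, map_one, one_pow, sub_self]
  exact I.zero_mem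

lemma nonempty_quotient_equiv_trivialModule [Fact p.Prime] [CharP k p] (hG : ∀ g : G, g ^ p = 1)
    (I : Ideal (MonoidAlgebra k G)) [hI : I.IsPrime] :
    Nonempty ((MonoidAlgebra k G ⧸ I) ≃ₗ[MonoidAlgebra k G] TrivialModule k G) := by
  let u : TrivialModule k G := fun _ => 1
  let q : MonoidAlgebra k G →ₗ[MonoidAlgebra k G] TrivialModule k G :=
    LinearMap.toSpanSingleton _ _ u
  have hq (x : MonoidAlgebra k G) : q x = x • u := rfl
  have hu (a : k) : (algebraMap k (MonoidAlgebra k G) a • u : TrivialModule k G) PUnit.unit = a :=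
    (funModule_algebraMap_smul a u _).trans (mul_one a)
  have hmem (x : MonoidAlgebra k G) :
      x - algebraMap k (MonoidAlgebra k G) ((q x : PUnit → k) PUnit.unit) ∈ I := by
    induction x using MonoidAlgebra.induction_on with
    | of g =>
      have : (q (MonoidAlgebra.of k G g) : PUnit → k) PUnit.unit = 1 := funModule_of_smul g u _
      rw [this, map_one]
      exact of_sub_one_mem_of_isPrime hG I g
    | add x y hx hy =>
      have : (q (x + y) : PUnit → k) PUnit.unit =
          (q x : PUnit → k) PUnit.unit + (q y : PUnit → k) PUnit.unit := by
        rw [map_add]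
        rfl
      rw [this, map_add, add_sub_add_comm]
      exact I.add_mem hx hy
    | smul r x hx =>
      have : (q (r • x) : PUnit → k) PUnit.unit = r * (q x : PUnit → k) PUnit.unit := by
        rw [Algebra.smul_def, hq, mul_smul]
        exact funModule_algebraMap_smul _ _ _
      rw [this, map_mul, Algebra.smul_def, ← mul_sub]
      exact I.mul_mem_left _ hx
  have hker : LinearMap.ker q = I := by
    ext x
    rw [LinearMap.mem_ker]
    constructor
    · intro hx
      have := hmem x
      rw [hx] at this
      change x - algebraMap k (MonoidAlgebra k G) 0 ∈ I at this
      rwa [map_zero, sub_zero] at this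
    · intro hx
      by_contra hne
      have h0 : (q x : PUnit → k) PUnit.unit ≠ 0 := fun h => hne (funext fun _ => h)
      refine hI.ne_top (I.eq_top_of_isUnit_mem ((I.sub_mem_iff_right hx).1 (hmem x)) ?_)
      exact (IsUnit.mk0 _ h0).map (algebraMap k (MonoidAlgebra k G))
  have hsurj : Function.Surjective q := fun v =>
    ⟨algebraMap k (MonoidAlgebra k G) ((v : PUnit → k) PUnit.unit), funext fun _ => hu _⟩
  exact ⟨(Submodule.quotEquivOfEq _ _ hker.symm).trans (q.quotKerEquivOfSurjective hsurj)⟩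

theorem exists_resolves_of_finite [Finite G] [Fact p.Prime] [CharP k p] (hG : ∀ g : G, g ^ p = 1)
    (hT : ∀ m, ∃ n, Resolves 0 n (freeClass k G m) (TrivialModule k G))
    (M : Type) [AddCommGroup M] [Module (MonoidAlgebra k G) M]
    [hM : Module.Finite (MonoidAlgebra k G) M] :
    ∀ m, ∃ n, Resolves 0 n (freeClass k G m) M := by
  have : IsNoetherianRing (MonoidAlgebra k G) := .of_finite k _
  induction hM using IsNoetherianRing.induction_on_isQuotientEquivQuotientPrime
    (A := MonoidAlgebra k G) with
  | subsingleton N => exact fun m => ⟨0, ‹Subsingleton N›⟩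
  | quotient N I φ =>
    intro m
    obtain ⟨n, hn⟩ := hT m
    have := I.2
    obtain ⟨ψ⟩ := nonempty_quotient_equiv_trivialModule (k := k) hG I.1
    exact ⟨n, hn.of_equiv (φ.trans ψ).symm⟩
  | exact L X N f g hf hg hfg hL hN =>
    intro m
    obtain ⟨n, hn⟩ := hL m
    obtain ⟨n', hn'⟩ := hN (max m n)
    exact Resolves.extension f g hf hg hfg (torsionSurjective_zero hg) hn hn'
      (fun i hi Q _ _ hQ => (hQ.2 (lt_max_of_lt_right hi)).torsionProjective 0)
      (freeClass_punit _) (fun i Q _ _ hQ => ⟨hQ.1, fun h => hQ.2 (lt_max_of_lt_left h)⟩)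
      (fun i P Q _ _ _ _ hP hQ =>
        ⟨hP.1.prod hQ.1, fun h => (hP.2 h).prod (hQ.2 (lt_max_of_lt_left h))⟩)

end Conclusion

/-- **Proposition.** Every finite-dimensional module over an elementary abelian `p`-group
`E = (C_p)^r` (in characteristic `p`) admits good permutation resolutions. -/
theorem elementaryAbelian_hasGoodPermRes
    (p : ℕ) (hp : p.Prime) (k : Type) [Field k] [CharP k p] (r : ℕ)
    (M : Type) [AddCommGroup M]
    [Module (MonoidAlgebra k (Fin r → Multiplicative (ZMod p))) M]
    [Module.Finite (MonoidAlgebra k (Fin r → Multiplicative (ZMod p))) M] :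
    HasGoodPermRes k (Fin r → Multiplicative (ZMod p)) M := by
  have : Fact p.Prime := ⟨hp⟩
  have hG (g : Fin r → Multiplicative (ZMod p)) : g ^ p = 1 := by
    funext i
    rw [Pi.pow_apply, Pi.one_apply, ← ofAdd_toAdd (g i), ← ofAdd_nsmul, nsmul_eq_mul,
      ZMod.natCast_self, zero_mul, ofAdd_zero]
  intro m
  obtain ⟨n, hn⟩ := exists_resolves_of_finite (k := k) hG (exists_resolves_trivialModule r) M (m + 1)
  obtain ⟨P, d, ε, hP, hPn, hε, hdε, hdd⟩ := hn.exists_complex (freeClass_punit _)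
  exact ⟨n, P, d, ε, fun i => (hP i).1, fun i hi => ((hP i).2 (Nat.lt_succ_of_le hi)).free,
    fun i hi => hPn i hi.le, hε, hdε, hdd⟩
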